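/- Let M, N, P ≥ 5 be integers and let D(M,N,P) = ⟨a,b,c ∣ a^M = b^N = c^P = abc = 1⟩ be the von Dyck group. Then the elements u = a·b⁻¹ and v = c⁻¹·a freely generate a free subgroup of rank 2 of D(M,N,P); that is, the homomorphism from the free group on two generators to D(M,N,P) sending the generators to u and v is injective. -/

import Mathlib

/-- The relators of the von Dyck group D(M,N,P) = ⟨a,b,c ∣ a^M = b^N = c^P = abc = 1⟩,
with a = 0, b = 1, c = 2. -/
def vonDyckRels (M N P : ℕ) : Set (FreeGroup (Fin 3)) :=
  {(FreeGroup.of 0) ^ M, (FreeGroup.of 1) ^ N, (FreeGroup.of 2) ^ P,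
   FreeGroup.of 0 * FreeGroup.of 1 * FreeGroup.of 2}

/-- The von Dyck group D(M,N,P). -/
abbrev VonDyck (M N P : ℕ) : Type := PresentedGroup (vonDyckRels M N P)

theorem vd_ineq (C c k ν z : ℝ) (hC : 0.809 ≤ C) (hC1 : C ≤ 1) (hc : 0.809 ≤ c) (hc1 : c ≤ 1)
    (hz : 1.618 ≤ z) (hz2 : z ≤ 2) (hk : 0 ≤ k) (hν0 : 1.4 ≤ ν) (hkν : k * ν = 1 - c^2)
    (hν : ν = z + 2*C*c - (1-C^2)*k) :
    2.8 ≤ ν ∧ ν ≤ 4 ∧ k ≤ 0.124 := by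
  have h1 : 1 - c^2 ≤ 0.346 := by nlinarith
  have h2 : 1 - C^2 ≤ 0.346 := by nlinarith
  have h2' : 0 ≤ 1 - C^2 := by nlinarith
  have h3 : k ≤ 0.25 := by nlinarith
  have h4 : (1-C^2)*k ≤ 0.0865 := by nlinarith
  have h5 : 0.654 ≤ C*c := by nlinarith
  have h6 : 2.8 ≤ ν := by nlinarith
  refine ⟨h6, by nlinarith, by nlinarith⟩

set_option maxHeartbeats 1000000
theorem vd_i1 (C c k ν z : ℝ) (hC : 0.809 ≤ C) (hC1 : C ≤ 1) (hc : 0.809 ≤ c) (hc1 : c ≤ 1)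
    (hz : 1.618 ≤ z) (hz2 : z ≤ 2) (hk : 0 ≤ k) (hν0 : 2.8 ≤ ν) (hν4 : ν ≤ 4) (hk2 : k ≤ 0.124) (hkν : k * ν = 1 - c^2)
    (hν : ν = z + 2*C*c - (1-C^2)*k)
    (hS0 : 0 ≤ 1 - C^2) (hS : 1 - C^2 ≤ 0.346) (hkS : (1-C^2)*k ≤ 0.346*k) (hkS0 : 0 ≤ (1-C^2)*k) (hk3 : 2.8 * k ≤ 1 - c^2)
    (h5 : 0.654 ≤ C*c) :
    0 < C*ν - (1-C^2)*c - 2*(1-C^2)*k - 2*C*c := by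
  nlinarith

theorem vd_i2 (C c k ν z : ℝ) (hC : 0.809 ≤ C) (hC1 : C ≤ 1) (hc : 0.809 ≤ c) (hc1 : c ≤ 1)
    (hz : 1.618 ≤ z) (hz2 : z ≤ 2) (hk : 0 ≤ k) (hν0 : 2.8 ≤ ν) (hν4 : ν ≤ 4) (hk2 : k ≤ 0.124) (hkν : k * ν = 1 - c^2)
    (hν : ν = z + 2*C*c - (1-C^2)*k)
    (hS0 : 0 ≤ 1 - C^2) (hS : 1 - C^2 ≤ 0.346) (hkS : (1-C^2)*k ≤ 0.346*k) (hkS0 : 0 ≤ (1-C^2)*k) (hk3 : 2.8 * k ≤ 1 - c^2)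
    (h5 : 0.654 ≤ C*c) :
    0 < C*ν - (1-C^2)*c + 3*(1-C^2)*k + 3*C*c := by
  nlinarith

theorem vd_i3 (C c k ν z : ℝ) (hC : 0.809 ≤ C) (hC1 : C ≤ 1) (hc : 0.809 ≤ c) (hc1 : c ≤ 1)
    (hz : 1.618 ≤ z) (hz2 : z ≤ 2) (hk : 0 ≤ k) (hν0 : 2.8 ≤ ν) (hν4 : ν ≤ 4) (hk2 : k ≤ 0.124) (hkν : k * ν = 1 - c^2)
    (hν : ν = z + 2*C*c - (1-C^2)*k)
    (hS0 : 0 ≤ 1 - C^2) (hS : 1 - C^2 ≤ 0.346) (hkS : (1-C^2)*k ≤ 0.346*k) (hkS0 : 0 ≤ (1-C^2)*k) (hk3 : 2.8 * k ≤ 1 - c^2)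
    (h5 : 0.654 ≤ C*c) :
    0 < (C*c+ν+(1-C^2)*c-C*ν) + 2*(C*k-c+(1-C^2)*k+C*c) := by
  nlinarith

theorem vd_i4 (C c k ν z : ℝ) (hC : 0.809 ≤ C) (hC1 : C ≤ 1) (hc : 0.809 ≤ c) (hc1 : c ≤ 1)
    (hz : 1.618 ≤ z) (hz2 : z ≤ 2) (hk : 0 ≤ k) (hν0 : 2.8 ≤ ν) (hν4 : ν ≤ 4) (hk2 : k ≤ 0.124) (hkν : k * ν = 1 - c^2)
    (hν : ν = z + 2*C*c - (1-C^2)*k)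
    (hS0 : 0 ≤ 1 - C^2) (hS : 1 - C^2 ≤ 0.346) (hkS : (1-C^2)*k ≤ 0.346*k) (hkS0 : 0 ≤ (1-C^2)*k) (hk3 : 2.8 * k ≤ 1 - c^2)
    (h5 : 0.654 ≤ C*c) :
    0 < (C*c+ν+(1-C^2)*c-C*ν) - 3*(C*k-c+(1-C^2)*k+C*c) := by
  nlinarith

theorem vd_i6 (C c k ν z : ℝ) (hC : 0.809 ≤ C) (hC1 : C ≤ 1) (hc : 0.809 ≤ c) (hc1 : c ≤ 1)
    (hz : 1.618 ≤ z) (hz2 : z ≤ 2) (hk : 0 ≤ k) (hν0 : 2.8 ≤ ν) (hν4 : ν ≤ 4) (hk2 : k ≤ 0.124) (hkν : k * ν = 1 - c^2)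
    (hν : ν = z + 2*C*c - (1-C^2)*k)
    (hS0 : 0 ≤ 1 - C^2) (hS : 1 - C^2 ≤ 0.346) (hkS : (1-C^2)*k ≤ 0.346*k) (hkS0 : 0 ≤ (1-C^2)*k) (hk3 : 2.8 * k ≤ 1 - c^2)
    (h5 : 0.654 ≤ C*c) :
    0 < -C*(1-C)*ν + c*(2*C^2-1+2*C*(1-C^2)) - k*(1-C^2)*(C+(1-C^2)) := by
  have h : (1-C)*C*ν ≤ (1-C)*C*(2+2*C*c) := by
    apply mul_le_mul_of_nonneg_left
    · linarith
    · apply mul_nonneg <;> linarith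
  have h3 : k * (C + (1-C^2)) ≤ 0.124 * 1.2 := by
    apply mul_le_mul hk2 <;> nlinarith only [hC, hC1]
  have h4 : k*(1-C^2)*(C+(1-C^2)) ≤ 0.16*(1-C^2) := by
    nlinarith only [h3, hS0]
  nlinarith only [h, h4, hC, hC1, hc, hc1, hS0, hS, h5]


theorem vd_i5 (C c k ν z : ℝ) (hC : 0.809 ≤ C) (hC1 : C ≤ 1) (hc : 0.809 ≤ c) (hc1 : c ≤ 1)
    (hz : 1.618 ≤ z) (hz2 : z ≤ 2) (hk : 0 ≤ k) (hν0 : 2.8 ≤ ν) (hν4 : ν ≤ 4) (hk2 : k ≤ 0.124) (hkν : k * ν = 1 - c^2)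
    (hν : ν = z + 2*C*c - (1-C^2)*k)
    (hS0 : 0 ≤ 1 - C^2) (hS : 1 - C^2 ≤ 0.346) (hkS : (1-C^2)*k ≤ 0.346*k) (hkS0 : 0 ≤ (1-C^2)*k) (hk3 : 2.8 * k ≤ 1 - c^2)
    (h5 : 0.654 ≤ C*c) :
    0 < -((-C*(1-C)*ν + c*(2*C^2-1+2*C*(1-C^2)) - k*(1-C^2)*(C+(1-C^2))) + 2*(ν - 2*C*c - C^2*k + (-(1-C^2)*c - C*ν + C^2*c-C*(1-C^2)*k))) := by
  have h : (1-C)*(2-C)*ν ≤ (1-C)*(2-C)*(2+2*C*c) := by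
    apply mul_le_mul_of_nonneg_left <;> nlinarith
  nlinarith

theorem vd_i8 (C c k ν z : ℝ) (hC : 0.809 ≤ C) (hC1 : C ≤ 1) (hc : 0.809 ≤ c) (hc1 : c ≤ 1)
    (hz : 1.618 ≤ z) (hz2 : z ≤ 2) (hk : 0 ≤ k) (hν0 : 2.8 ≤ ν) (hν4 : ν ≤ 4) (hk2 : k ≤ 0.124) (hkν : k * ν = 1 - c^2)
    (hν : ν = z + 2*C*c - (1-C^2)*k)
    (hS0 : 0 ≤ 1 - C^2) (hS : 1 - C^2 ≤ 0.346) (hkS : (1-C^2)*k ≤ 0.346*k) (hkS0 : 0 ≤ (1-C^2)*k) (hk3 : 2.8 * k ≤ 1 - c^2)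
    (h5 : 0.654 ≤ C*c) :
    0 < -(3*(C^2*c - C*ν - (1-C^2)*C*k - (1-C^2)*c) + (2*C*(1-C^2)*c+C^2*ν-(1-C^2)^2*k)) := by
  have h : C*(3-C)*2.8 ≤ C*(3-C)*ν := by
    apply mul_le_mul_of_nonneg_left <;> nlinarith
  nlinarith

theorem vd_i7 (C c k ν z : ℝ) (hC : 0.809 ≤ C) (hC1 : C ≤ 1) (hc : 0.809 ≤ c) (hc1 : c ≤ 1)
    (hz : 1.618 ≤ z) (hz2 : z ≤ 2) (hk : 0 ≤ k) (hν0 : 2.8 ≤ ν) (hν4 : ν ≤ 4) (hk2 : k ≤ 0.124) (hkν : k * ν = 1 - c^2)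
    (hν : ν = z + 2*C*c - (1-C^2)*k)
    (hS0 : 0 ≤ 1 - C^2) (hS : 1 - C^2 ≤ 0.346) (hkS : (1-C^2)*k ≤ 0.346*k) (hkS0 : 0 ≤ (1-C^2)*k) (hk3 : 2.8 * k ≤ 1 - c^2)
    (h5 : 0.654 ≤ C*c) :
    0 < 5*(C^2*c - C*ν - (1-C^2)*C*k - (1-C^2)*c) + (2*C*(1-C^2)*c+C^2*ν-(1-C^2)^2*k) + 6*(ν-2*C*c-C^2*k) := by
  have h : (2-C)*(3-C)*(1.618+2*C*c-(1-C^2)*k) ≤ (2-C)*(3-C)*ν := by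
    apply mul_le_mul_of_nonneg_left <;> nlinarith
  have e : k * ((2-C)*(3-C)*(1-C^2) + 5*(1-C^2)*C+(1-C^2)^2+6*C^2) ≤ k * 6.4 := by
    apply mul_le_mul_of_nonneg_left <;> nlinarith
  have e2 : 0 < (2-C)*(3-C)*(1.618+2*C*c) + 5*(C^2*c - (1-C^2)*c) + 2*C*(1-C^2)*c - 12*C*c - 2.286*(1-c^2) := by
    nlinarith
  nlinarith


theorem vd_pow (A : Matrix (Fin 2) (Fin 2) ℝ) (θ : ℝ) (hd : A.det = 1)
    (ht : A.trace = 2 * Real.cos θ) (n : ℕ) :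
    Real.sin θ • A ^ (n+1) = Real.sin ((n+1)*θ) • A - Real.sin (n*θ) • (1 : Matrix (Fin 2) (Fin 2) ℝ) := by
  have h2 : A * A = (2 * Real.cos θ) • A - 1 := by
    rw [← ht]
    rw [Matrix.det_fin_two] at hd
    ext i j
    fin_cases i <;> fin_cases j <;>
      simp [Matrix.mul_apply, Fin.sum_univ_two, Matrix.trace_fin_two] <;> linarith
  induction n with
  | zero => simp
  | succ n ih =>
    rw [pow_succ, ← smul_mul_assoc, ih, sub_mul, smul_mul_assoc, h2, smul_mul_assoc, one_mul,
      smul_sub, smul_smul]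
    have e : Real.sin ((((n+1 : ℕ) : ℝ) + 1) * θ) =
        Real.sin ((n+1)*θ) * (2 * Real.cos θ) - Real.sin (n*θ) := by
      have e1 : (((n+1 : ℕ) : ℝ) + 1) * θ = (n+1)*θ + θ := by push_cast; ring
      have e2 : (n:ℝ)*θ = (n+1)*θ - θ := by ring
      rw [e1, e2, Real.sin_add, Real.sin_sub]; ring
    rw [e, sub_smul]
    push_cast
    abel

theorem vd_pow_eq (A : Matrix (Fin 2) (Fin 2) ℝ) (M : ℕ) (hM : 5 ≤ M) (hd : A.det = 1)
    (ht : A.trace = 2 * Real.cos (Real.pi / M)) : A ^ M = -1 := by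
  obtain ⟨n, rfl⟩ : ∃ n, M = n + 1 := ⟨M - 1, by omega⟩
  have h := vd_pow A _ hd ht n
  have hpos : (0:ℝ) < ((n+1 : ℕ) : ℝ) := by positivity
  have h5 : (5:ℝ) ≤ ((n+1 : ℕ) : ℝ) := by exact_mod_cast hM
  have hs : 0 < Real.sin (Real.pi / ((n+1 : ℕ) : ℝ)) := by
    apply Real.sin_pos_of_pos_of_lt_pi
    · positivity
    · rw [div_lt_iff₀ hpos]; nlinarith [Real.pi_pos]
  have e1 : ((n:ℝ)+1) * (Real.pi / ((n+1 : ℕ) : ℝ)) = Real.pi := by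
    push_cast; field_simp
  have e2 : (n:ℝ) * (Real.pi / ((n+1 : ℕ) : ℝ)) = Real.pi - Real.pi / ((n+1 : ℕ) : ℝ) := by
    push_cast; field_simp; ring
  rw [e1, e2, Real.sin_pi, Real.sin_pi_sub, zero_smul, zero_sub, ← smul_neg] at h
  exact smul_right_injective _ hs.ne' h

open scoped MatrixGroups in
theorem vd_center (g : SL(2, ℝ)) (M : ℕ) (hM : 5 ≤ M)
    (ht : g.1.trace = 2 * Real.cos (Real.pi / M)) : g ^ M ∈ Subgroup.center SL(2, ℝ) := by
  rw [Matrix.SpecialLinearGroup.mem_center_iff]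
  refine ⟨-1, by simp, ?_⟩
  rw [Matrix.SpecialLinearGroup.coe_pow, vd_pow_eq g.1 M hM g.2 ht]
  simp [← Matrix.diagonal_one]

theorem vd_cos (M : ℕ) (hM : 5 ≤ M) : 0.809 ≤ Real.cos (Real.pi / M) := by
  have h5 : (5:ℝ) ≤ (M : ℝ) := by exact_mod_cast hM
  have h : Real.cos (Real.pi / 5) ≤ Real.cos (Real.pi / M) := by
    apply Real.cos_le_cos_of_nonneg_of_le_pi
    · positivity
    · nlinarith [Real.pi_pos]
    · apply div_le_div_of_nonneg_left <;> first | positivity | assumption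
  rw [Real.cos_pi_div_five] at h
  have : (2.236:ℝ) ≤ √5 := by
    apply Real.le_sqrt_of_sq_le; norm_num
  linarith

/-- two forms with nonnegative product, not both zero -/
theorem vd_sign {α β γ δ L R : ℝ} (hα : 0 < α) (hβ : 0 < β) (hγ : 0 < γ) (hδ : 0 < δ)
    (h : 0 ≤ L * R) (h0 : L ≠ 0 ∨ R ≠ 0) : 0 < (α * L + β * R) * (γ * L + δ * R) := by
  have e : (α * L + β * R) * (γ * L + δ * R) =
    (α * γ) * L^2 + (β * δ) * R^2 + (α * δ + β * γ) * (L * R) := by ring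
  rw [e]
  have h1 : 0 ≤ (α * δ + β * γ) * (L * R) := by positivity
  rcases h0 with h0 | h0
  · have : 0 < (α * γ) * L^2 := by positivity
    have : 0 ≤ (β * δ) * R^2 := by positivity
    linarith
  · have : 0 ≤ (α * γ) * L^2 := by positivity
    have : 0 < (β * δ) * R^2 := by positivity
    linarith

open scoped MatrixGroups Pointwise in
theorem vd_pingpong (U V : SL(2, ℝ))
    (hU : ∀ p q : ℝ, (p ≠ 0 ∨ q ≠ 0) → 0 ≤ (3*p+q)*(2*p-q) →
      (U.1 1 0 * p + U.1 1 1 * q) * ((U.1 0 0 * p + U.1 0 1 * q) + (U.1 1 0 * p + U.1 1 1 * q)) < 0)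
    (hV : ∀ p q : ℝ, (p ≠ 0 ∨ q ≠ 0) → (2*p-q)*q ≤ 0 →
      ((V.1 0 0 * p + V.1 0 1 * q) + (V.1 1 0 * p + V.1 1 1 * q)) *
      (3*(V.1 0 0 * p + V.1 0 1 * q) + (V.1 1 0 * p + V.1 1 1 * q)) < 0) :
    Function.Injective (FreeGroup.lift ![U, V]) := by
  have hne : ∀ g : SL(2, ℝ), g.1 0 0 ≠ 0 ∨ g.1 1 0 ≠ 0 := by
    intro g
    by_contra! h
    have := g.2
    rw [Matrix.det_fin_two, h.1, h.2] at this
    simp at this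
  have m0 : ∀ g h : SL(2, ℝ), (g * h).1 0 0 = g.1 0 0 * h.1 0 0 + g.1 0 1 * h.1 1 0 := by
    intro g h; simp [Matrix.mul_apply, Fin.sum_univ_two]
  have m1 : ∀ g h : SL(2, ℝ), (g * h).1 1 0 = g.1 1 0 * h.1 0 0 + g.1 1 1 * h.1 1 0 := by
    intro g h; simp [Matrix.mul_apply, Fin.sum_univ_two]
  set XU : Set SL(2, ℝ) := {g | g.1 1 0 * (g.1 0 0 + g.1 1 0) < 0} with hXU
  set XV : Set SL(2, ℝ) := {g | (g.1 0 0 + g.1 1 0) * (3 * g.1 0 0 + g.1 1 0) < 0} with hXV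
  set YU : Set SL(2, ℝ) := {g | (3 * g.1 0 0 + g.1 1 0) * (2 * g.1 0 0 - g.1 1 0) < 0} with hYU
  set YV : Set SL(2, ℝ) := {g | 0 < (2 * g.1 0 0 - g.1 1 0) * g.1 1 0} with hYV
  have kU : ∀ g, g ∉ YU → U * g ∈ XU := by
    intro g hg
    simp only [hYU, Set.mem_ofPred_eq, not_lt] at hg
    simp only [hXU, Set.mem_ofPred_eq, m0, m1]
    exact hU _ _ (hne g) hg
  have kV : ∀ g, g ∉ YV → V * g ∈ XV := by
    intro g hg
    simp only [hYV, Set.mem_ofPred_eq, not_lt] at hg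
    simp only [hXV, Set.mem_ofPred_eq, m0, m1]
    exact hV _ _ (hne g) hg
  have d1 : Disjoint XU XV := by
    rw [Set.disjoint_left]; intro g h1 h2
    simp only [hXU, hXV, Set.mem_ofPred_eq] at h1 h2
    rcases mul_neg_iff.1 h1 with h1 | h1 <;> rcases mul_neg_iff.1 h2 with h2 | h2 <;> linarith
  have d2 : Disjoint YU YV := by
    rw [Set.disjoint_left]; intro g h1 h2
    simp only [hYU, hYV, Set.mem_ofPred_eq] at h1 h2
    rcases mul_neg_iff.1 h1 with h1 | h1 <;> rcases mul_pos_iff.1 h2 with h2 | h2 <;> linarith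
  have d3 : Disjoint XU YU := by
    rw [Set.disjoint_left]; intro g h1 h2
    simp only [hXU, hYU, Set.mem_ofPred_eq] at h1 h2
    rcases mul_neg_iff.1 h1 with h1 | h1 <;> rcases mul_neg_iff.1 h2 with h2 | h2 <;> linarith
  have d4 : Disjoint XU YV := by
    rw [Set.disjoint_left]; intro g h1 h2
    simp only [hXU, hYV, Set.mem_ofPred_eq] at h1 h2
    rcases mul_neg_iff.1 h1 with h1 | h1 <;> rcases mul_pos_iff.1 h2 with h2 | h2 <;> linarith
  have d5 : Disjoint XV YU := by
    rw [Set.disjoint_left]; intro g h1 h2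
    simp only [hXV, hYU, Set.mem_ofPred_eq] at h1 h2
    rcases mul_neg_iff.1 h1 with h1 | h1 <;> rcases mul_neg_iff.1 h2 with h2 | h2 <;> linarith
  have d6 : Disjoint XV YV := by
    rw [Set.disjoint_left]; intro g h1 h2
    simp only [hXV, hYV, Set.mem_ofPred_eq] at h1 h2
    rcases mul_neg_iff.1 h1 with h1 | h1 <;> rcases mul_pos_iff.1 h2 with h2 | h2 <;> linarith
  have n1 : (1 : SL(2, ℝ)) ∉ YU := by
    rw [hYU, Set.mem_ofPred_eq, Matrix.SpecialLinearGroup.coe_one]; norm_num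
  have n2 : (1 : SL(2, ℝ)) ∉ YV := by
    rw [hYV, Set.mem_ofPred_eq, Matrix.SpecialLinearGroup.coe_one]; norm_num
  apply FreeGroup.injective_lift_of_ping_pong (α := SL(2, ℝ)) ![U, V] ![XU, XV] ![YU, YV]
  · intro i; fin_cases i
    · exact ⟨_, kU _ n1⟩
    · exact ⟨_, kV _ n2⟩
  · intro i j hij
    fin_cases i <;> fin_cases j <;> first | exact absurd rfl hij | exact d1 | exact d1.symm
  · intro i j hij
    fin_cases i <;> fin_cases j <;> first | exact absurd rfl hij | exact d2 | exact d2.symm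
  · intro i j
    fin_cases i <;> fin_cases j
    · exact d3
    · exact d4
    · exact d5
    · exact d6
  · intro i; fin_cases i
    · rintro _ ⟨g, hg, rfl⟩; exact kU g hg
    · rintro _ ⟨g, hg, rfl⟩; exact kV g hg
  · intro i; fin_cases i
    · rintro _ ⟨g, hg, rfl⟩
      by_contra h
      have := kU _ h
      apply hg
      simpa using this
    · rintro _ ⟨g, hg, rfl⟩
      by_contra h
      have := kV _ h
      apply hg
      simpa using this

open scoped MatrixGroups in
theorem vd_reduce (M N P : ℕ) (A B : SL(2, ℝ))
    (hA : A ^ M ∈ Subgroup.center SL(2, ℝ)) (hB : B ^ N ∈ Subgroup.center SL(2, ℝ))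
    (hAB : (A * B) ^ P ∈ Subgroup.center SL(2, ℝ))
    (hinj : Function.Injective (FreeGroup.lift ![A * B⁻¹, A * B * A])) :
    Function.Injective
      (FreeGroup.lift
        (![(PresentedGroup.of 0) * (PresentedGroup.of 1)⁻¹,
           (PresentedGroup.of 2)⁻¹ * (PresentedGroup.of 0)] : Fin 2 → VonDyck M N P)) := by
  let π := QuotientGroup.mk' (Subgroup.center SL(2, ℝ))
  have key : ∀ g : SL(2, ℝ), π g = 1 ↔ g ∈ Subgroup.center SL(2, ℝ) := fun g =>
    QuotientGroup.eq_one_iff g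
  let f : Fin 3 → SL(2, ℝ) ⧸ Subgroup.center SL(2, ℝ) := ![π A, π B, (π (A * B))⁻¹]
  have hf : ∀ r ∈ vonDyckRels M N P, FreeGroup.lift f r = 1 := by
    intro r hr
    rcases hr with rfl | rfl | rfl | rfl
    · simp only [map_pow, FreeGroup.lift_apply_of]
      change (π A) ^ M = 1
      rw [← map_pow, key]; exact hA
    · simp only [map_pow, FreeGroup.lift_apply_of]
      change (π B) ^ N = 1
      rw [← map_pow, key]; exact hB
    · simp only [map_pow, FreeGroup.lift_apply_of]
      change ((π (A * B))⁻¹) ^ P = 1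
      rw [inv_pow, ← map_pow, inv_eq_one, key]; exact hAB
    · simp only [map_mul, FreeGroup.lift_apply_of]
      change π A * π B * (π (A * B))⁻¹ = 1
      rw [map_mul]; simp
  let φ : VonDyck M N P →* SL(2, ℝ) ⧸ Subgroup.center SL(2, ℝ) := PresentedGroup.toGroup hf
  have hφ : ∀ i, φ (PresentedGroup.of i) = f i := fun i => PresentedGroup.toGroup.of hf
  have hcomp : φ.comp (FreeGroup.lift
        (![(PresentedGroup.of 0) * (PresentedGroup.of 1)⁻¹,
           (PresentedGroup.of 2)⁻¹ * (PresentedGroup.of 0)] : Fin 2 → VonDyck M N P)) =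
      π.comp (FreeGroup.lift ![A * B⁻¹, A * B * A]) := by
    ext i
    fin_cases i
    · simp [hφ, f]
    · simp [hφ, f]
  rw [injective_iff_map_eq_one]
  intro w hw
  have h1 : π (FreeGroup.lift ![A * B⁻¹, A * B * A] w) = 1 := by
    rw [← MonoidHom.comp_apply, ← hcomp, MonoidHom.comp_apply, hw, map_one]
  rw [key, Matrix.SpecialLinearGroup.mem_center_iff] at h1
  obtain ⟨r, hr, hs⟩ := h1
  have h2 : (FreeGroup.lift ![A * B⁻¹, A * B * A] w) ^ 2 = 1 := by
    apply Subtype.ext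
    rw [Matrix.SpecialLinearGroup.coe_pow, ← hs, ← map_pow]
    have hr2 : r ^ 2 = 1 := by simpa only [Fintype.card_fin] using hr
    rw [hr2, map_one, Matrix.SpecialLinearGroup.coe_one]
  rw [← map_pow] at h2
  have h3 : w ^ 2 = 1 := hinj (by rw [h2, map_one])
  exact (pow_eq_one_iff_left (by norm_num)).1 h3

open scoped MatrixGroups in
theorem neg_pow_eq_or (g : SL(2, ℝ)) (n : ℕ) : (-g) ^ n = g ^ n ∨ (-g) ^ n = - g ^ n := by
  rcases Nat.even_or_odd n with h | h
  · left; exact h.neg_pow g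
  · right; exact h.neg_pow g

theorem vonDyck_free_subgroup (M N P : ℕ) (hM : 5 ≤ M) (hN : 5 ≤ N) (hP : 5 ≤ P) :
    Function.Injective
      (FreeGroup.lift
        (![(PresentedGroup.of 0) * (PresentedGroup.of 1)⁻¹,
           (PresentedGroup.of 2)⁻¹ * (PresentedGroup.of 0)] : Fin 2 → VonDyck M N P)) := by
  set C := Real.cos (Real.pi / M) with hCd
  set c := Real.cos (Real.pi / N) with hcd
  set z := 2 * Real.cos (Real.pi / P) with hzd
  have hC : 0.809 ≤ C := vd_cos M hM
  have hc : 0.809 ≤ c := vd_cos N hN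
  have hz : 1.618 ≤ z := by have := vd_cos P hP; linarith
  have hC1 : C ≤ 1 := Real.cos_le_one _
  have hc1 : c ≤ 1 := Real.cos_le_one _
  have hz2 : z ≤ 2 := by have := Real.cos_le_one (Real.pi / P); linarith
  have hS0 : 0 ≤ 1 - C^2 := by nlinarith
  have hS : 1 - C^2 ≤ 0.346 := by nlinarith
  have hs0 : 0 ≤ 1 - c^2 := by nlinarith
  have hs : 1 - c^2 ≤ 0.346 := by nlinarith
  have h5 : 0.654 ≤ C*c := by nlinarith
  obtain ⟨ν, hν0, hνe⟩ : ∃ ν : ℝ, 1.4 ≤ ν ∧ ν^2 - (z + 2*C*c)*ν + (1-C^2)*(1-c^2) = 0 := by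
    set t := (z + 2*C*c)/2 with ht
    have ht1 : 1.4 ≤ t := by linarith
    have hD : 0 ≤ t^2 - (1-C^2)*(1-c^2) := by nlinarith
    refine ⟨t + √(t^2 - (1-C^2)*(1-c^2)), by linarith [Real.sqrt_nonneg (t^2 - (1-C^2)*(1-c^2))], ?_⟩
    have := Real.sq_sqrt hD
    have e : z + 2*C*c = 2*t := by rw [ht]; ring
    rw [e]
    linarith
  have hνpos : 0 < ν := by linarith
  set k := (1 - c^2)/ν with hkd
  have hk : 0 ≤ k := by positivity
  have hkν : k * ν = 1 - c^2 := by rw [hkd]; field_simp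
  have hν : ν = z + 2*C*c - (1-C^2)*k := by
    rw [← hkν] at hνe
    have : ν * (ν - (z + 2*C*c - (1-C^2)*k)) = 0 := by linarith
    rcases mul_eq_zero.1 this with h | h
    · exact absurd h hνpos.ne'
    · linarith
  obtain ⟨hν2, hν4, hk2⟩ := vd_ineq C c k ν z hC hC1 hc hc1 hz hz2 hk hν0 hkν hν
  have hkS : (1-C^2)*k ≤ 0.346*k := mul_le_mul_of_nonneg_right hS hk
  have hkS0 : 0 ≤ (1-C^2)*k := mul_nonneg hS0 hk
  have hk3 : 2.8 * k ≤ 1 - c^2 := by nlinarith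
  have i1 := vd_i1 C c k ν z hC hC1 hc hc1 hz hz2 hk hν2 hν4 hk2 hkν hν hS0 hS hkS hkS0 hk3 h5
  have i2 := vd_i2 C c k ν z hC hC1 hc hc1 hz hz2 hk hν2 hν4 hk2 hkν hν hS0 hS hkS hkS0 hk3 h5
  have i3 := vd_i3 C c k ν z hC hC1 hc hc1 hz hz2 hk hν2 hν4 hk2 hkν hν hS0 hS hkS hkS0 hk3 h5
  have i4 := vd_i4 C c k ν z hC hC1 hc hc1 hz hz2 hk hν2 hν4 hk2 hkν hν hS0 hS hkS hkS0 hk3 h5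
  have i5 := vd_i5 C c k ν z hC hC1 hc hc1 hz hz2 hk hν2 hν4 hk2 hkν hν hS0 hS hkS hkS0 hk3 h5
  have i6 := vd_i6 C c k ν z hC hC1 hc hc1 hz hz2 hk hν2 hν4 hk2 hkν hν hS0 hS hkS hkS0 hk3 h5
  have i7 := vd_i7 C c k ν z hC hC1 hc hc1 hz hz2 hk hν2 hν4 hk2 hkν hν hS0 hS hkS hkS0 hk3 h5
  have i8 := vd_i8 C c k ν z hC hC1 hc hc1 hz hz2 hk hν2 hν4 hk2 hkν hν hS0 hS hkS hkS0 hk3 h5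
  let A : Matrix.SpecialLinearGroup (Fin 2) ℝ :=
    ⟨!![C, -1; 1 - C^2, C], by rw [Matrix.det_fin_two_of]; ring⟩
  let B : Matrix.SpecialLinearGroup (Fin 2) ℝ :=
    ⟨!![c, -k; ν, c], by rw [Matrix.det_fin_two_of]; linarith⟩
  have hAv : A.1 = !![C, -1; 1 - C^2, C] := rfl
  have hBv : B.1 = !![c, -k; ν, c] := rfl
  have hABv : (A * B).1 = !![C*c-ν, -C*k-c; (1-C^2)*c+C*ν, -(1-C^2)*k+C*c] := by
    rw [Matrix.SpecialLinearGroup.coe_mul, hAv, hBv, Matrix.mul_fin_two]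
    congr! 3 <;> ring_nf
  have hUv : (A * B⁻¹).1 = !![C*c+ν, C*k-c; (1-C^2)*c-C*ν, (1-C^2)*k+C*c] := by
    rw [Matrix.SpecialLinearGroup.coe_mul, Matrix.SpecialLinearGroup.coe_inv, hAv, hBv,
      Matrix.adjugate_fin_two_of, Matrix.mul_fin_two]
    congr! 3 <;> ring_nf
  have hVv : (A * B * A).1 = !![(C*c-ν)*C + (-C*k-c)*(1-C^2), -(C*c-ν) + (-C*k-c)*C;
      ((1-C^2)*c+C*ν)*C + (-(1-C^2)*k+C*c)*(1-C^2), -((1-C^2)*c+C*ν) + (-(1-C^2)*k+C*c)*C] := by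
    rw [Matrix.SpecialLinearGroup.coe_mul, hABv, hAv, Matrix.mul_fin_two]
    congr! 3 <;> ring_nf
  apply vd_reduce M N P A B
  · apply vd_center A M hM
    rw [hAv, Matrix.trace_fin_two_of, ← hCd]; ring
  · apply vd_center B N hN
    rw [hBv, Matrix.trace_fin_two_of, ← hcd]; ring
  · have h := vd_center (-(A * B)) P hP (by
      rw [Matrix.SpecialLinearGroup.coe_neg, hABv, Matrix.trace_neg, Matrix.trace_fin_two_of, ← hzd]
      linarith)
    rcases neg_pow_eq_or (A * B) P with h' | h'
    · rwa [h'] at h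
    · rw [h'] at h
      rw [Subgroup.mem_center_iff] at h ⊢
      intro g
      have := h g
      simpa using this
  · apply vd_pingpong
    · intro p q h0 h
      rw [hUv]
      simp only [Matrix.of_apply, Matrix.cons_val', Matrix.cons_val_zero, Matrix.cons_val_one,
        Matrix.cons_val_fin_one]
      have h0' : 3*p+q ≠ 0 ∨ 2*p-q ≠ 0 := by
        by_contra! hh
        rcases h0 with h0 | h0 <;> apply h0 <;> linarith [hh.1, hh.2]
      have := vd_sign i1 i2 i3 i4 h h0'
      linarith
    · intro p q h0 h
      rw [hVv]
      simp only [Matrix.of_apply, Matrix.cons_val', Matrix.cons_val_zero, Matrix.cons_val_one,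
        Matrix.cons_val_fin_one]
      have h0' : q ≠ 0 ∨ q - 2*p ≠ 0 := by
        by_contra! hh
        rcases h0 with h0 | h0 <;> apply h0 <;> linarith [hh.1, hh.2]
      have := vd_sign i5 i6 i7 i8 (L := q) (R := q-2*p) (by linarith) h0'
      linarith
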